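/- arXiv:1710.07402 — 2 statements merged into one kernel-verified Lean document; each statement's English description precedes it below -/
import Mathlib

section
/- Suppose B_l ∈ ℝ^{m×n} are entrywise positive matrices for l ∈ ℕ with B_l → B as l → ∞. Then lim_{l→∞} ρ(A,B_l) = ρ̂(A,B) (as a limit in [0,∞]). -/
open Matrix Filter
open scoped ENNReal Topology

/-- `r(A,B,x) = inf{t ∈ [0,∞] : A x ≤ t B x entrywise}`, valued in `ℝ≥0∞`
(the infimum of the empty set being `⊤`). -/
noncomputable def cwR {m n : ℕ} (A B : Matrix (Fin m) (Fin n) ℝ) (x : Fin n → ℝ) : ℝ≥0∞ :=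
  sInf {t : ℝ≥0∞ | ∃ s : ℝ, 0 ≤ s ∧ t = ENNReal.ofReal s ∧
    ∀ i, A.mulVec x i ≤ s * B.mulVec x i}

/-- The Collatz–Wielandt quotient `ρ(A,B) = inf{r(A,B,x) : x > 0 entrywise}`. -/
noncomputable def cwRho {m n : ℕ} (A B : Matrix (Fin m) (Fin n) ℝ) : ℝ≥0∞ :=
  sInf {t : ℝ≥0∞ | ∃ x : Fin n → ℝ, (∀ j, 0 < x j) ∧ t = cwR A B x}

/-- The weak Collatz–Wielandt quotient `ρ̂(A,B) = inf{r(A,B,x) : x ≥ 0, x ≠ 0}`. -/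
noncomputable def cwRhoHat {m n : ℕ} (A B : Matrix (Fin m) (Fin n) ℝ) : ℝ≥0∞ :=
  sInf {t : ℝ≥0∞ | ∃ x : Fin n → ℝ, (∀ j, 0 ≤ x j) ∧ x ≠ 0 ∧ t = cwR A B x}

lemma mulVec_apply_nonneg {m n : ℕ} {B : Matrix (Fin m) (Fin n) ℝ} {x : Fin n → ℝ} {i : Fin m}
    (hB : ∀ j, 0 ≤ B i j) (hx : ∀ j, 0 ≤ x j) : 0 ≤ B.mulVec x i := by
  rw [mulVec, dotProduct]
  exact Finset.sum_nonneg fun j _ => mul_nonneg (hB j) (hx j)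

lemma cwR_lt_iff {m n : ℕ} {A B : Matrix (Fin m) (Fin n) ℝ} {x : Fin n → ℝ} {t : ℝ≥0∞} :
    cwR A B x < t ↔
      ∃ s : ℝ, 0 ≤ s ∧ ENNReal.ofReal s < t ∧ ∀ i, A.mulVec x i ≤ s * B.mulVec x i := by
  rw [cwR, sInf_lt_iff]
  constructor
  · rintro ⟨_, ⟨s, hs, rfl, h⟩, hlt⟩
    exact ⟨s, hs, hlt, h⟩
  · rintro ⟨s, hs, hlt, h⟩
    exact ⟨_, ⟨s, hs, rfl, h⟩, hlt⟩

lemma cwRho_lt_iff {m n : ℕ} {A B : Matrix (Fin m) (Fin n) ℝ} {t : ℝ≥0∞} :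
    cwRho A B < t ↔ ∃ x : Fin n → ℝ, (∀ j, 0 < x j) ∧ ∃ s : ℝ, 0 ≤ s ∧
      ENNReal.ofReal s < t ∧ ∀ i, A.mulVec x i ≤ s * B.mulVec x i := by
  simp_rw [← cwR_lt_iff]
  rw [cwRho, sInf_lt_iff]
  constructor
  · rintro ⟨_, ⟨x, hx, rfl⟩, hlt⟩
    exact ⟨x, hx, hlt⟩
  · rintro ⟨x, hx, hlt⟩
    exact ⟨_, ⟨x, hx, rfl⟩, hlt⟩

lemma cwRhoHat_lt_iff {m n : ℕ} {A B : Matrix (Fin m) (Fin n) ℝ} {t : ℝ≥0∞} :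
    cwRhoHat A B < t ↔ ∃ x : Fin n → ℝ, (∀ j, 0 ≤ x j) ∧ x ≠ 0 ∧ ∃ s : ℝ, 0 ≤ s ∧
      ENNReal.ofReal s < t ∧ ∀ i, A.mulVec x i ≤ s * B.mulVec x i := by
  simp_rw [← cwR_lt_iff]
  rw [cwRhoHat, sInf_lt_iff]
  constructor
  · rintro ⟨_, ⟨x, hx, hx0, rfl⟩, hlt⟩
    exact ⟨x, hx, hx0, hlt⟩
  · rintro ⟨x, hx, hx0, hlt⟩
    exact ⟨_, ⟨x, hx, hx0, rfl⟩, hlt⟩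

/-- A strict inequality `A x < s B x` at a nonnegative vector persists at a positive vector. -/
lemma exists_pos_mulVec_le {m n : ℕ} {A B : Matrix (Fin m) (Fin n) ℝ} {x : Fin n → ℝ} {s : ℝ}
    (hx : ∀ j, 0 ≤ x j) (h : ∀ i, A.mulVec x i < s * B.mulVec x i) :
    ∃ y : Fin n → ℝ, (∀ j, 0 < y j) ∧ ∀ i, A.mulVec y i ≤ s * B.mulVec y i := by
  have key : ∀ᶠ ε in 𝓝 (0 : ℝ), ∀ i,
      A.mulVec (fun j => x j + ε) i < s * B.mulVec (fun j => x j + ε) i := by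
    rw [eventually_all]
    intro i
    have hA : Continuous fun ε : ℝ => A.mulVec (fun j => x j + ε) i := by
      simp only [mulVec, dotProduct]
      fun_prop
    have hB : Continuous fun ε : ℝ => s * B.mulVec (fun j => x j + ε) i := by
      simp only [mulVec, dotProduct]
      fun_prop
    exact hA.continuousAt.eventually_lt hB.continuousAt (by simpa using h i)
  obtain ⟨ε, hε, hε0⟩ := ((key.filter_mono nhdsWithin_le_nhds).and
    (self_mem_nhdsWithin : Set.Ioi (0 : ℝ) ∈ 𝓝[>] 0)).exists
  exact ⟨fun j => x j + ε, fun j => add_pos_of_nonneg_of_pos (hx j) hε0, fun i => (hε i).le⟩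

/-- The matrices `M` for which `A x ≤ s M x` is solvable in the standard simplex form a closed
set. -/
lemma isClosed_setOf_exists_stdSimplex_mulVec_le {m n : ℕ} (A : Matrix (Fin m) (Fin n) ℝ)
    (s : ℝ) :
    IsClosed {M : Matrix (Fin m) (Fin n) ℝ |
      ∃ x ∈ stdSimplex ℝ (Fin n), ∀ i, A.mulVec x i ≤ s * M.mulVec x i} := by
  have hK : IsClosed {p : stdSimplex ℝ (Fin n) × Matrix (Fin m) (Fin n) ℝ |
      ∀ i, A.mulVec p.1.1 i ≤ s * p.2.mulVec p.1.1 i} := by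
    simp only [Set.ofPred_forall]
    refine isClosed_iInter fun i => isClosed_le ?_ ?_
    · exact (continuous_apply i).comp
        (continuous_const.matrix_mulVec (continuous_subtype_val.comp continuous_fst))
    · exact continuous_const.mul ((continuous_apply i).comp
        (continuous_snd.matrix_mulVec (continuous_subtype_val.comp continuous_fst)))
  convert isClosedMap_snd_of_compactSpace _ hK using 1
  ext M
  constructor
  · rintro ⟨x, hx, h⟩
    exact ⟨(⟨x, hx⟩, M), h, rfl⟩
  · rintro ⟨p, h, rfl⟩
    exact ⟨p.1.1, p.1.2, h⟩

/-- A solution of `A x ≤ s B x` can be rescaled into the standard simplex. -/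
lemma exists_stdSimplex_mulVec_le {m n : ℕ} {A B : Matrix (Fin m) (Fin n) ℝ} {x : Fin n → ℝ}
    {s : ℝ} (hn : 0 < n) (hx : ∀ j, 0 < x j) (h : ∀ i, A.mulVec x i ≤ s * B.mulVec x i) :
    ∃ y ∈ stdSimplex ℝ (Fin n), ∀ i, A.mulVec y i ≤ s * B.mulVec y i := by
  have hsum : 0 < ∑ j, x j :=
    Finset.sum_pos (fun j _ => hx j) ⟨⟨0, hn⟩, Finset.mem_univ _⟩
  refine ⟨(∑ j, x j)⁻¹ • x, ⟨fun j => ?_, ?_⟩, fun i => ?_⟩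
  · exact mul_nonneg (inv_nonneg.2 hsum.le) (hx j).le
  · simp only [Pi.smul_apply, smul_eq_mul, ← Finset.mul_sum]
    exact inv_mul_cancel₀ hsum.ne'
  · simp only [mulVec_smul, Pi.smul_apply, smul_eq_mul]
    rw [mul_left_comm]
    exact mul_le_mul_of_nonneg_left (h i) (inv_nonneg.2 hsum.le)

/-- If positive matrices `B_l` converge to `B`, then `ρ(A,B_l) → ρ̂(A,B)`. -/
theorem stmt7 {m n : ℕ} (hm : 0 < m) (hn : 0 < n)
    (A B : Matrix (Fin m) (Fin n) ℝ)
    (hA : ∀ i j, 0 ≤ A i j) (hB : ∀ i j, 0 ≤ B i j)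
    (Bl : ℕ → Matrix (Fin m) (Fin n) ℝ)
    (hBl : ∀ l i j, 0 < Bl l i j)
    (hlim : Tendsto Bl atTop (𝓝 B)) :
    Tendsto (fun l => cwRho A (Bl l)) atTop (𝓝 (cwRhoHat A B)) := by
  rw [tendsto_order]
  constructor
  · intro a ha
    obtain ⟨b, hab, hb⟩ := exists_between ha
    obtain ⟨c, hbc, hc⟩ := exists_between hb
    have hb_top : b ≠ ⊤ := hb.ne_top
    have hB_not : B ∉ {M : Matrix (Fin m) (Fin n) ℝ |
        ∃ x ∈ stdSimplex ℝ (Fin n), ∀ i, A.mulVec x i ≤ b.toReal * M.mulVec x i} := by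
      rintro ⟨x, hx, h⟩
      refine hc.not_gt (cwRhoHat_lt_iff.2 ⟨x, hx.1, ?_, b.toReal, ENNReal.toReal_nonneg, ?_, h⟩)
      · rintro rfl
        simpa using hx.2
      · rwa [ENNReal.ofReal_toReal hb_top]
    filter_upwards [hlim.eventually
      ((isClosed_setOf_exists_stdSimplex_mulVec_le A b.toReal).isOpen_compl.mem_nhds hB_not)]
      with l hl
    by_contra! hle
    obtain ⟨x, hx, s, hs, hsb, h⟩ := cwRho_lt_iff.1 (hle.trans_lt hab)
    have hsb' : s ≤ b.toReal := ((ENNReal.ofReal_lt_iff_lt_toReal hs hb_top).1 hsb).le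
    refine hl (exists_stdSimplex_mulVec_le hn hx fun i => (h i).trans ?_)
    exact mul_le_mul_of_nonneg_right hsb'
      (mulVec_apply_nonneg (fun j => (hBl l i j).le) fun j => (hx j).le)
  · intro a ha
    obtain ⟨x, hx, hx0, s, hs, hsa, h⟩ := cwRhoHat_lt_iff.1 ha
    obtain ⟨b, hsb, hba⟩ := exists_between hsa
    have hb_top : b ≠ ⊤ := hba.ne_top
    have hsb' : s < b.toReal := (ENNReal.ofReal_lt_iff_lt_toReal hs hb_top).1 hsb
    have hstrict : ∀ᶠ l in atTop, ∀ i, A.mulVec x i < b.toReal * (Bl l).mulVec x i := by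
      rw [eventually_all]
      intro i
      have hBx : 0 ≤ B.mulVec x i := mulVec_apply_nonneg (hB i) hx
      rcases hBx.eq_or_lt with h0 | hpos
      · refine Eventually.of_forall fun l => ?_
        have hAx : A.mulVec x i ≤ 0 := by simpa [← h0] using h i
        obtain ⟨j, hj⟩ := Function.ne_iff.1 hx0
        have hBlx : 0 < (Bl l).mulVec x i :=
          Finset.sum_pos' (fun j _ => mul_nonneg (hBl l i j).le (hx j))
            ⟨j, Finset.mem_univ j, mul_pos (hBl l i j) ((hx j).lt_of_ne' hj)⟩
        exact hAx.trans_lt (mul_pos (hs.trans_lt hsb') hBlx)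
      · have hcont : Continuous fun M : Matrix (Fin m) (Fin n) ℝ => b.toReal * M.mulVec x i :=
          continuous_const.mul
            ((continuous_apply i).comp (continuous_id.matrix_mulVec continuous_const))
        exact ((hcont.tendsto B).comp hlim).eventually_const_lt
          ((h i).trans_lt (mul_lt_mul_of_pos_right hsb' hpos))
    filter_upwards [hstrict] with l hl
    obtain ⟨y, hy, hyl⟩ := exists_pos_mulVec_le hx hl
    refine cwRho_lt_iff.2 ⟨y, hy, b.toReal, ENNReal.toReal_nonneg, ?_, hyl⟩
    rwa [ENNReal.ofReal_toReal hb_top]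
end

section
/- Let A, B ∈ ℝ_+^{m×n} be a WN-pair and let M(B) be the set of all K ⊆ [n] with |K| = m such that B[[m],K] is monomial. Then ρ(A,B) = min{ ρ(B[[m],K]^{-1} A[[m],K]) : K ∈ M(B) }, where ρ of a square matrix denotes its spectral radius. Moreover, for each K ∈ M(B) achieving this minimum there exists an optimal probability vector y whose support is contained in K and which is a generalized Perron–Frobenius eigenvector, i.e., A y = ρ(A,B) B y. -/
open Matrix Filter
open scoped ENNReal Topology

/-- The spectral radius of a real square matrix: the supremum of the absolute values
(norms) of its complex eigenvalues. -/
noncomputable def specRad {m : ℕ} (C : Matrix (Fin m) (Fin m) ℝ) : ℝ≥0∞ :=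
  spectralRadius ℂ (C.map Complex.ofReal)

/-- A WN-pair: `A, B` nonnegative `m×n` matrices with `m ≤ n`, `B` has no zero row,
and every column of `B` has exactly one positive entry. -/
def WNpair {m n : ℕ} (A B : Matrix (Fin m) (Fin n) ℝ) : Prop :=
  m ≤ n ∧ (∀ i j, 0 ≤ A i j) ∧ (∀ i j, 0 ≤ B i j) ∧
  (∀ i, ∃ j, 0 < B i j) ∧ (∀ j, ∃! i, 0 < B i j)

/-- A square nonnegative matrix is monomial if each row and each column has exactly
one positive entry. -/
def IsMonomial {m : ℕ} (C : Matrix (Fin m) (Fin m) ℝ) : Prop :=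
  (∀ i j, 0 ≤ C i j) ∧ (∀ i, ∃! j, 0 < C i j) ∧ (∀ j, ∃! i, 0 < C i j)

/-- `y` is optimal for the pair `(A,B)`: `r(A,B,y) = ρ(A,B)` and `y` is a limit of
entrywise positive vectors `y_k` with `r(A,B,y_k) → ρ(A,B)`. -/
def OptimalVec {m n : ℕ} (A B : Matrix (Fin m) (Fin n) ℝ) (y : Fin n → ℝ) : Prop :=
  (∀ j, 0 ≤ y j) ∧ y ≠ 0 ∧ cwR A B y = cwRho A B ∧
  ∃ yk : ℕ → Fin n → ℝ, (∀ k j, 0 < yk k j) ∧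
    Tendsto yk atTop (𝓝 y) ∧
    Tendsto (fun k => cwR A B (yk k)) atTop (𝓝 (cwRho A B))

section PerronFrobenius

variable {ι : Type*} [Fintype ι]

/-- A matrix with positive entries maps nonzero nonnegative vectors to positive vectors. -/
lemma mulVec_pos_of_pos {P : Matrix ι ι ℝ} (hP : ∀ i j, 0 < P i j) {w : ι → ℝ}
    (hw : ∀ i, 0 ≤ w i) {j : ι} (hj : 0 < w j) (i : ι) : 0 < (P *ᵥ w) i :=
  Finset.sum_pos' (fun k _ => mul_nonneg (hP i k).le (hw k))
    ⟨j, Finset.mem_univ j, mul_pos (hP i j) hj⟩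

/-- **Perron's theorem**: a matrix with positive entries has a positive eigenvector. -/
lemma exists_pos_eigenvector [Nonempty ι] {P : Matrix ι ι ℝ} (hP : ∀ i j, 0 < P i j) :
    ∃ (r : ℝ) (v : ι → ℝ), 0 < r ∧ (∀ i, 0 < v i) ∧ ∑ i, v i = 1 ∧ P *ᵥ v = r • v := by
  set T : ℝ := ∑ i, ∑ j, P i j
  set S : Set ((ι → ℝ) × ℝ) :=
    {p | p ∈ stdSimplex ℝ ι ×ˢ Set.Icc 0 T ∧ ∀ i, (P *ᵥ p.1) i ≤ p.2 * p.1 i}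
  have hT : 0 ≤ T := Finset.sum_nonneg fun i _ => Finset.sum_nonneg fun j _ => (hP i j).le
  have hScomp : IsCompact S := by
    refine ((isCompact_stdSimplex ℝ ι).prod isCompact_Icc).inter_right
      (t := {p | ∀ i, (P *ᵥ p.1) i ≤ p.2 * p.1 i}) ?_
    rw [Set.ofPred_forall]
    refine isClosed_iInter fun i => isClosed_le ?_ ?_
    · simp only [Matrix.mulVec, dotProduct]
      fun_prop
    · fun_prop
  have hSne : S.Nonempty := by
    have hN : (0 : ℝ) < Fintype.card ι := by exact_mod_cast Fintype.card_pos
    refine ⟨(fun _ => (Fintype.card ι : ℝ)⁻¹, T),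
      ⟨⟨fun i => by positivity, ?_⟩, hT, le_rfl⟩, fun i => ?_⟩
    · simp [hN.ne']
    · simp only [Matrix.mulVec, dotProduct, ← Finset.sum_mul]
      gcongr
      exact Finset.single_le_sum (f := fun i => ∑ j, P i j)
        (fun i _ => Finset.sum_nonneg fun j _ => (hP i j).le) (Finset.mem_univ i)
  obtain ⟨⟨v, t⟩, ⟨⟨⟨hv0, hv1⟩, ht0, htT⟩, hvt⟩, hmin⟩ :=
    hScomp.exists_isMinOn hSne continuous_snd.continuousOn
  simp only at hv0 hv1 ht0 htT hvt
  obtain ⟨j, hj⟩ : ∃ j, 0 < v j := by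
    by_contra! h
    linarith [Finset.sum_nonpos fun i (_ : i ∈ Finset.univ) => h i]
  have hPv := mulVec_pos_of_pos hP hv0 hj
  have htpos : 0 < t := by
    by_contra! h
    nlinarith [hPv j, hvt j]
  have hv : ∀ i, 0 < v i := fun i =>
    pos_of_mul_pos_right ((hPv i).trans_le (hvt i)) ht0
  refine ⟨t, v, htpos, hv, hv1, ?_⟩
  by_contra hne
  obtain ⟨k, hk⟩ : ∃ k, (P *ᵥ v) k < t * v k := by
    by_contra! h
    exact hne (funext fun i => le_antisymm (hvt i) (h i))
  set y := P *ᵥ v with hy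
  have hPy : ∀ i, (P *ᵥ y) i < t * y i := fun i => by
    have := mulVec_pos_of_pos hP (w := t • v - y) (fun i => sub_nonneg.2 (hvt i))
      (j := k) (sub_pos.2 hk) i
    rw [Matrix.mulVec_sub, Matrix.mulVec_smul, ← hy] at this
    simpa using this
  have hyy := mulVec_pos_of_pos hP (fun i => (hPv i).le) (hPv j)
  obtain ⟨i₀, -, hi₀⟩ := Finset.exists_max_image Finset.univ (fun i => (P *ᵥ y) i / y i)
    Finset.univ_nonempty
  set t' := (P *ᵥ y) i₀ / y i₀
  have ht' : t' < t := (div_lt_iff₀ (hPv i₀)).2 (hPy i₀)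
  have hs : 0 < ∑ i, y i := Finset.sum_pos (fun i _ => hPv i) Finset.univ_nonempty
  have hmem : ((∑ i, y i)⁻¹ • y, t') ∈ S := by
    refine ⟨⟨⟨fun i => mul_nonneg (inv_pos.2 hs).le (hPv i).le, ?_⟩,
      (div_pos (hyy i₀) (hPv i₀)).le, ht'.le.trans htT⟩, fun i => ?_⟩
    · simp only [Pi.smul_apply, smul_eq_mul, ← Finset.mul_sum]
      exact inv_mul_cancel₀ hs.ne'
    · simp only [Matrix.mulVec_smul, Pi.smul_apply, smul_eq_mul]
      rw [mul_left_comm]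
      have := (div_le_iff₀ (hPv i)).1 (hi₀ i (Finset.mem_univ i))
      gcongr
  exact absurd (hmin hmem) (not_le.2 ht')

end PerronFrobenius

section SpectralRadius

variable {m : ℕ} {C : Matrix (Fin m) (Fin m) ℝ} {v : Fin m → ℝ} {r : ℝ}

/-- A nonnegative real eigenvalue is at most the spectral radius. -/
lemma ofReal_le_specRad (hr : 0 ≤ r) (hv : v ≠ 0) (h : C *ᵥ v = r • v) :
    ENNReal.ofReal r ≤ specRad C := by
  have hmem : (r : ℂ) ∈ spectrum ℂ (C.map Complex.ofReal) := by
    rw [← Matrix.spectrum_toLin']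
    refine (Module.End.hasEigenvalue_of_hasEigenvector
      (x := fun i => (v i : ℂ)) ⟨?_, ?_⟩).mem_spectrum
    · rw [Module.End.mem_eigenspace_iff, Matrix.toLin'_apply]
      ext i
      have := congrArg Complex.ofReal (congrFun h i)
      simpa [Matrix.mulVec, dotProduct] using this
    · intro h0
      exact hv (funext fun i => by simpa using congrFun h0 i)
  refine le_trans (le_of_eq ?_) (le_iSup₂ (f := fun k _ => (‖k‖₊ : ℝ≥0∞)) (r : ℂ) hmem)
  rw [← enorm_eq_nnnorm, ← ofReal_norm, Complex.norm_real, Real.norm_of_nonneg hr]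

/-- The Collatz–Wielandt upper bound for the spectral radius of a nonnegative matrix. -/
lemma specRad_le_ofReal (hC : ∀ i j, 0 ≤ C i j) (hv : ∀ i, 0 < v i)
    (h : ∀ i, (C *ᵥ v) i ≤ r * v i) : specRad C ≤ ENNReal.ofReal r := by
  refine iSup₂_le fun μ hμ => ?_
  rw [← Matrix.spectrum_toLin', ← Module.End.hasEigenvalue_iff_mem_spectrum] at hμ
  obtain ⟨w, hw, hw0⟩ := hμ.exists_hasEigenvector
  rw [Module.End.mem_eigenspace_iff, Matrix.toLin'_apply] at hw
  obtain ⟨j, hj⟩ : ∃ j, w j ≠ 0 := Function.ne_iff.1 hw0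
  obtain ⟨i, -, hi⟩ := Finset.exists_max_image Finset.univ (fun i => ‖w i‖ / v i)
    ⟨j, Finset.mem_univ j⟩
  set c := ‖w i‖ / v i with hc
  have hcpos : 0 < c := (div_pos (norm_pos_iff.2 hj) (hv j)).trans_le (hi j (Finset.mem_univ j))
  have hwle : ∀ k, ‖w k‖ ≤ c * v k := fun k =>
    (div_le_iff₀ (hv k)).1 (hi k (Finset.mem_univ k))
  have hwi : ‖w i‖ = c * v i := by rw [hc, div_mul_cancel₀ _ (hv i).ne']
  have key : ‖μ‖ * (c * v i) ≤ r * (c * v i) :=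
    calc ‖μ‖ * (c * v i) = ‖(C.map Complex.ofReal *ᵥ w) i‖ := by rw [hw, ← hwi]; simp
      _ ≤ ∑ k, C i k * ‖w k‖ := by
        simp only [Matrix.mulVec, dotProduct]
        refine (norm_sum_le _ _).trans (Finset.sum_le_sum fun k _ => ?_)
        simp [abs_of_nonneg (hC i k)]
      _ ≤ ∑ k, C i k * (c * v k) :=
        Finset.sum_le_sum fun k _ => mul_le_mul_of_nonneg_left (hwle k) (hC i k)
      _ = c * (C *ᵥ v) i := by
        simp only [Matrix.mulVec, dotProduct, Finset.mul_sum]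
        exact Finset.sum_congr rfl fun k _ => by ring
      _ ≤ r * (c * v i) := by nlinarith [mul_le_mul_of_nonneg_left (h i) hcpos.le]
  have hμr : ‖μ‖ ≤ r := le_of_mul_le_mul_right key (mul_pos hcpos (hv i))
  rw [← enorm_eq_nnnorm, ← ofReal_norm]
  exact ENNReal.ofReal_le_ofReal hμr

/-- The spectral radius of a nonnegative matrix `C` is an eigenvalue, with a nonnegative
eigenvector which is a limit of positive eigenvectors of positive perturbations of `C`. -/
lemma exists_perturbed_eigenvectors (hm : 0 < m) (hC : ∀ i j, 0 ≤ C i j) :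
    ∃ (r : ℝ) (v : Fin m → ℝ) (ε rk : ℕ → ℝ) (vk : ℕ → Fin m → ℝ),
      0 ≤ r ∧ v ∈ stdSimplex ℝ (Fin m) ∧ C *ᵥ v = r • v ∧ specRad C = ENNReal.ofReal r ∧
      (∀ k, 0 < ε k) ∧ (∀ k, 0 ≤ rk k) ∧ (∀ k i, 0 < vk k i) ∧
      (∀ k i, (C *ᵥ vk k) i + ε k = rk k * vk k i) ∧
      Tendsto vk atTop (𝓝 v) ∧ Tendsto rk atTop (𝓝 r) := by
  have : Nonempty (Fin m) := ⟨⟨0, hm⟩⟩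
  set ε : ℕ → ℝ := fun k => 1 / ((k : ℝ) + 1)
  have hε : ∀ k, 0 < ε k := fun k => Nat.one_div_pos_of_nat
  have hε1 : ∀ k, ε k ≤ 1 := fun k => by
    rw [div_le_one (by positivity)]
    linarith [(k.cast_nonneg : (0 : ℝ) ≤ k)]
  have hpert : ∀ k, ∃ p : (Fin m → ℝ) × ℝ, 0 < p.2 ∧ (∀ i, 0 < p.1 i) ∧ ∑ i, p.1 i = 1 ∧
      ∀ i, (C *ᵥ p.1) i + ε k = p.2 * p.1 i := fun k => by
    obtain ⟨r, v, hr, hv, hv1, h⟩ := exists_pos_eigenvector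
      (P := C + Matrix.of fun _ _ => ε k) fun i j => add_pos_of_nonneg_of_pos (hC i j) (hε k)
    refine ⟨(v, r), hr, hv, hv1, fun i => ?_⟩
    have := congrFun h i
    rw [Matrix.add_mulVec] at this
    simpa [Matrix.mulVec, dotProduct, ← Finset.mul_sum, hv1] using this
  choose p hp0 hpv hp1 hp using hpert
  set T : ℝ := ∑ i, (∑ j, C i j + 1)
  have hbound : ∀ k, p k ∈ stdSimplex ℝ (Fin m) ×ˢ Set.Icc (0 : ℝ) T := fun k => by
    refine ⟨⟨fun i => (hpv k i).le, hp1 k⟩, (hp0 k).le, ?_⟩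
    calc (p k).2 = ∑ i, ((C *ᵥ (p k).1) i + ε k) := by
          simp_rw [hp k, ← Finset.mul_sum, hp1 k, mul_one]
      _ ≤ T := by
          refine Finset.sum_le_sum fun i _ => add_le_add ?_ (hε1 k)
          change ∑ j, C i j * (p k).1 j ≤ ∑ j, C i j
          refine Finset.sum_le_sum fun j _ => ?_
          refine mul_le_of_le_one_right (hC i j) ?_
          rw [← hp1 k]
          exact Finset.single_le_sum (fun j _ => (hpv k j).le) (Finset.mem_univ j)
  obtain ⟨⟨v, r⟩, ⟨hv, hr, -⟩, φ, hφ, hlim⟩ :=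
    ((isCompact_stdSimplex ℝ (Fin m)).prod isCompact_Icc).tendsto_subseq hbound
  simp only at hv hr
  have hlimv : Tendsto (fun k => (p (φ k)).1) atTop (𝓝 v) := (continuous_fst.tendsto _).comp hlim
  have hlimr : Tendsto (fun k => (p (φ k)).2) atTop (𝓝 r) := (continuous_snd.tendsto _).comp hlim
  have hlimε : Tendsto (fun k => ε (φ k)) atTop (𝓝 0) :=
    tendsto_one_div_add_atTop_nhds_zero_nat.comp hφ.tendsto_atTop
  have hCv : C *ᵥ v = r • v := by
    ext i
    have hcont : Continuous fun x : Fin m → ℝ => (C *ᵥ x) i := by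
      simp only [Matrix.mulVec, dotProduct]
      fun_prop
    have h1 := ((hcont.tendsto v).comp hlimv).add hlimε
    have h2 := hlimr.mul ((continuous_apply i).tendsto v |>.comp hlimv)
    simp only [add_zero] at h1
    refine tendsto_nhds_unique h1 (h2.congr fun k => ?_)
    exact (hp (φ k) i).symm
  have hv0 : v ≠ 0 := by
    rintro rfl
    simpa using hv.2
  refine ⟨r, v, fun k => ε (φ k), fun k => (p (φ k)).2, fun k => (p (φ k)).1, hr, hv, hCv,
    le_antisymm ?_ (ofReal_le_specRad hr hv0 hCv), fun k => hε _, fun k => (hp0 _).le,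
    fun k => hpv _, fun k => hp _, hlimv, hlimr⟩
  exact ge_of_tendsto' (ENNReal.tendsto_ofReal hlimr) fun k =>
    specRad_le_ofReal hC (hpv _) fun i => by linarith [hp (φ k) i, hε (φ k)]

end SpectralRadius

section Monomial

variable {m : ℕ}

/-- A monomial matrix has a nonnegative left inverse. -/
lemma IsMonomial.exists_nonneg_left_inverse {M : Matrix (Fin m) (Fin m) ℝ} (hM : IsMonomial M) :
    ∃ D : Matrix (Fin m) (Fin m) ℝ, (∀ i j, 0 ≤ D i j) ∧ D * M = 1 := by
  obtain ⟨h0, hrow, hcol⟩ := hM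
  choose σ hσ hσu using hcol
  refine ⟨Matrix.of fun k i => if i = σ k then (M i k)⁻¹ else 0, fun k i => ?_, ?_⟩
  · simp only [Matrix.of_apply]
    split_ifs
    exacts [inv_nonneg.2 (h0 _ _), le_rfl]
  · ext k l
    simp only [Matrix.mul_apply, Matrix.of_apply, ite_mul, zero_mul, Finset.sum_ite_eq',
      Finset.mem_univ, if_true, Matrix.one_apply]
    split_ifs with hkl
    · subst hkl
      exact inv_mul_cancel₀ (hσ k).ne'
    · rw [mul_eq_zero]
      refine Or.inr (le_antisymm (not_lt.1 fun hl => hkl ?_) (h0 _ _))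
      exact (hrow (σ k)).unique (hσ k) hl

end Monomial

section CollatzWielandt

variable {m n : ℕ} {A B : Matrix (Fin m) (Fin n) ℝ}

lemma cwR_le_ofReal {x : Fin n → ℝ} {s : ℝ} (hs : 0 ≤ s)
    (h : ∀ i, (A *ᵥ x) i ≤ s * (B *ᵥ x) i) : cwR A B x ≤ ENNReal.ofReal s :=
  sInf_le ⟨s, hs, rfl, h⟩

lemma cwRho_le_cwR {x : Fin n → ℝ} (hx : ∀ j, 0 < x j) : cwRho A B ≤ cwR A B x :=
  sInf_le ⟨x, hx, rfl⟩

/-- The Collatz–Wielandt quotient of a generalized eigenvector is its eigenvalue. -/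
lemma cwR_eq_ofReal {x : Fin n → ℝ} {r : ℝ} (hr : 0 ≤ r) (h : A *ᵥ x = r • B *ᵥ x)
    {i : Fin m} (hi : 0 < (B *ᵥ x) i) : cwR A B x = ENNReal.ofReal r := by
  refine le_antisymm (cwR_le_ofReal hr fun k => (congrFun h k).le) (le_sInf ?_)
  rintro _ ⟨s, -, rfl, hs⟩
  refine ENNReal.ofReal_le_ofReal (le_of_mul_le_mul_right ?_ hi)
  exact (congrFun h i).symm.le.trans (hs i)

/-- The action of `A` on a vector extended by zero from a selection of columns. -/
lemma mulVec_extend (A : Matrix (Fin m) (Fin n) ℝ) {e : Fin m → Fin n}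
    (he : Function.Injective e) (v : Fin m → ℝ) :
    A *ᵥ Function.extend e v 0 = (Matrix.of fun i k => A i (e k)) *ᵥ v := by
  ext i
  simp only [Matrix.mulVec, dotProduct, Matrix.of_apply]
  symm
  refine Finset.sum_of_injOn e he.injOn (by simp) (fun j _ hj => ?_) fun k _ => ?_
  · rw [Function.extend_apply' _ _ _ (by simpa using hj)]
    simp
  · rw [he.extend_apply]

/-- A positive multiplier making finitely many quantities small. -/
lemma exists_pos_mul_le {ι : Type*} [Finite ι] (a : ι → ℝ) {c : ι → ℝ} (hc : ∀ i, 0 < c i)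
    {η : ℝ} (hη : 0 < η) : ∃ δ, 0 < δ ∧ δ < η ∧ ∀ i, δ * a i ≤ c i := by
  have h : ∀ᶠ δ in 𝓝[>] (0 : ℝ), ∀ i, δ * a i ≤ c i := by
    refine eventually_all.2 fun i => nhdsWithin_le_nhds ?_
    have : Tendsto (fun δ : ℝ => δ * a i) (𝓝 0) (𝓝 0) := by
      simpa using (continuous_mul_const (a i)).tendsto (0 : ℝ)
    exact this.eventually (ge_mem_nhds (hc i))
  obtain ⟨δ, hδ, h0, h1⟩ := (h.and (Ioo_mem_nhdsGT hη)).exists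
  exact ⟨δ, h0, h1, hδ⟩

/-- Each monomial selection of columns carries a generalized eigenvector for the spectral radius
of the selection, and this vector is approximated by positive vectors. -/
lemma exists_generalized_eigenvector (hm : 0 < m) (hA : ∀ i j, 0 ≤ A i j) (hB : ∀ i j, 0 ≤ B i j)
    {e : Fin m → Fin n} (he : Function.Injective e)
    (hM : IsMonomial (Matrix.of fun i k => B i (e k))) :
    ∃ (r : ℝ) (y : Fin n → ℝ) (rk : ℕ → ℝ) (yk : ℕ → Fin n → ℝ),
      0 ≤ r ∧ specRad ((Matrix.of fun i k => B i (e k))⁻¹ * (Matrix.of fun i k => A i (e k))) =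
        ENNReal.ofReal r ∧
      (∀ j, 0 ≤ y j) ∧ ∑ j, y j = 1 ∧ (∀ j, 0 < y j → ∃ k, e k = j) ∧
      A *ᵥ y = r • B *ᵥ y ∧ (∃ i, 0 < (B *ᵥ y) i) ∧ (∀ k j, 0 < yk k j) ∧
      (∀ k, cwR A B (yk k) ≤ ENNReal.ofReal (rk k)) ∧
      Tendsto yk atTop (𝓝 y) ∧ Tendsto rk atTop (𝓝 r) := by
  set M := Matrix.of fun i k => B i (e k) with hMdef
  set N := Matrix.of fun i k => A i (e k) with hNdef
  obtain ⟨D, hD0, hD⟩ := hM.exists_nonneg_left_inverse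
  have hMC : M * (M⁻¹ * N) = N := by
    rw [Matrix.inv_eq_left_inv hD, ← mul_assoc, mul_eq_one_comm.1 hD, one_mul]
  have hC : ∀ i j, 0 ≤ (M⁻¹ * N) i j := fun i j => by
    rw [Matrix.inv_eq_left_inv hD, Matrix.mul_apply]
    exact Finset.sum_nonneg fun k _ => mul_nonneg (hD0 _ _) (hA _ _)
  set C := M⁻¹ * N
  obtain ⟨r, v, ε, rk, vk, hr, ⟨hv0, hv1⟩, hCv, hrho, hε, hrk, hvk, hpert, hlimv, hlimr⟩ :=
    exists_perturbed_eigenvectors hm hC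
  have hM1 : ∀ i, 0 < ∑ k, M i k := fun i => by
    obtain ⟨k, hk, -⟩ := hM.2.1 i
    exact Finset.sum_pos' (fun l _ => hM.1 i l) ⟨k, Finset.mem_univ k, hk⟩
  have hA1 : ∀ k : ℕ, ∃ δ : ℝ, 0 < δ ∧ δ < 1 / ((k : ℝ) + 1) ∧
      ∀ i, δ * (A *ᵥ 1) i ≤ ε k * ∑ l, M i l := fun k =>
    exists_pos_mul_le _ (fun i => mul_pos (hε k) (hM1 i)) Nat.one_div_pos_of_nat
  choose δ hδ0 hδ1 hδ using hA1
  have hext : ∀ x : Fin m → ℝ, (∀ k, 0 ≤ x k) → ∀ j, 0 ≤ Function.extend e x 0 j := by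
    intro x hx j
    by_cases hj : ∃ k, e k = j
    · obtain ⟨k, rfl⟩ := hj
      rw [he.extend_apply]
      exact hx k
    · rw [Function.extend_apply' _ _ _ hj]
      rfl
  have hδlim : Tendsto δ atTop (𝓝 0) :=
    squeeze_zero (fun k => (hδ0 k).le) (fun k => (hδ1 k).le) tendsto_one_div_add_atTop_nhds_zero_nat
  refine ⟨r, Function.extend e v 0, rk, fun k => Function.extend e (vk k) 0 + δ k • 1, hr, hrho,
    hext v hv0, ?_, ?_, ?_, ?_, ?_, ?_, ?_, hlimr⟩
  · rw [← hv1]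
    symm
    refine Finset.sum_of_injOn e he.injOn (by simp) (fun j _ hj => ?_) fun k _ => ?_
    · rw [Function.extend_apply' _ _ _ (by simpa using hj)]
      rfl
    · rw [he.extend_apply]
  · intro j hj
    by_contra h
    rw [Function.extend_apply' _ _ _ h] at hj
    exact lt_irrefl _ hj
  · rw [mulVec_extend A he, mulVec_extend B he, ← hMdef, ← hNdef, ← hMC, ← Matrix.mulVec_mulVec,
      hCv, Matrix.mulVec_smul]
  · rw [mulVec_extend B he, ← hMdef]
    obtain ⟨k, hk⟩ : ∃ k, 0 < v k := by
      by_contra! h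
      linarith [Finset.sum_nonpos fun i (_ : i ∈ Finset.univ) => h i]
    obtain ⟨i, hi, -⟩ := hM.2.2 k
    exact ⟨i, Finset.sum_pos' (fun l _ => mul_nonneg (hM.1 i l) (hv0 l))
      ⟨k, Finset.mem_univ k, mul_pos hi hk⟩⟩
  · intro k j
    have := hext _ (fun i => (hvk k i).le) j
    simpa using add_pos_of_nonneg_of_pos this (hδ0 k)
  · refine fun k => cwR_le_ofReal (hrk k) fun i => ?_
    have hCk : C *ᵥ vk k = rk k • vk k - ε k • 1 := by
      ext l
      simpa using eq_sub_of_add_eq (hpert k l)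
    have hM1i : (M *ᵥ (1 : Fin m → ℝ)) i = ∑ l, M i l := by simp [Matrix.mulVec, dotProduct]
    have hB1 : 0 ≤ (B *ᵥ (1 : Fin n → ℝ)) i :=
      dotProduct_nonneg_of_nonneg (hB i) zero_le_one
    rw [Matrix.mulVec_add, Matrix.mulVec_add, mulVec_extend A he, mulVec_extend B he, ← hMdef,
      ← hNdef, ← hMC, ← Matrix.mulVec_mulVec, hCk]
    simp only [Matrix.mulVec_sub, Matrix.mulVec_smul, Pi.add_apply, Pi.sub_apply, Pi.smul_apply,
      smul_eq_mul, hM1i]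
    nlinarith [hδ k i, mul_nonneg (hrk k) (mul_nonneg (hδ0 k).le hB1)]
  · rw [tendsto_pi_nhds]
    intro j
    have h2 : Tendsto (fun k => Function.extend e (vk k) 0 j) atTop
        (𝓝 (Function.extend e v 0 j)) := by
      by_cases hj : ∃ k, e k = j
      · obtain ⟨k, rfl⟩ := hj
        simp only [he.extend_apply]
        exact (tendsto_pi_nhds.1 hlimv) k
      · simp only [Function.extend_apply' _ _ _ hj]
        exact tendsto_const_nhds
    simpa using h2.add hδlim

end CollatzWielandt

section Selection

variable {m n : ℕ} {A B : Matrix (Fin m) (Fin n) ℝ}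

/-- Among the column selections of a pair whose first member is positive there is one with a
positive eigenvector whose eigenvalue is at most every Collatz–Wielandt bound. -/
lemma exists_selection_of_pos (hm : 0 < m) (hA : ∀ i j, 0 < A i j) (hB : ∀ i j, 0 ≤ B i j)
    (hrow : ∀ i, ∃ j, 0 < B i j) (hcol : ∀ j, ∃! i, 0 < B i j) {x : Fin n → ℝ}
    (hx : ∀ j, 0 < x j) {t : ℝ} (hxt : ∀ i, (A *ᵥ x) i ≤ t * (B *ᵥ x) i) :
    ∃ (e : Fin m → Fin n) (r : ℝ) (v : Fin m → ℝ), (∀ i, 0 < B i (e i)) ∧ r ≤ t ∧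
      (∀ i, 0 < v i) ∧ ∀ i, ∑ l, A i (e l) * v l = r * (B i (e i) * v i) := by
  have : Nonempty (Fin m) := ⟨⟨0, hm⟩⟩
  have hright : ∀ e : {e : Fin m → Fin n // ∀ i, 0 < B i (e i)}, ∃ (r : ℝ) (v : Fin m → ℝ),
      (∀ i, 0 < v i) ∧ ∀ i, ∑ l, A i (e.1 l) * v l = r * (B i (e.1 i) * v i) := by
    rintro ⟨e, he⟩
    obtain ⟨r, v, -, hv, -, h⟩ := exists_pos_eigenvector
      (P := Matrix.of fun i l => (B i (e i))⁻¹ * A i (e l))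
      fun i l => mul_pos (inv_pos.2 (he i)) (hA _ _)
    refine ⟨r, v, hv, fun i => ?_⟩
    have := congrFun h i
    simp only [Matrix.mulVec, dotProduct, Matrix.of_apply, mul_assoc, ← Finset.mul_sum,
      Pi.smul_apply, smul_eq_mul] at this
    rw [inv_mul_eq_iff_eq_mul₀ (he i).ne'] at this
    rw [this]
    ring
  choose ρ v hv hρ using hright
  choose e₁ he₁ using hrow
  have : Nonempty {e : Fin m → Fin n // ∀ i, 0 < B i (e i)} := ⟨⟨e₁, he₁⟩⟩
  obtain ⟨⟨e, he⟩, hmin⟩ := Finite.exists_min ρ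
  obtain ⟨s, w, -, hw, -, h⟩ := exists_pos_eigenvector
    (P := Matrix.of fun l k => (B l (e l))⁻¹ * A k (e l))
    fun l k => mul_pos (inv_pos.2 (he l)) (hA _ _)
  have hleft : ∀ l, ∑ k, w k * A k (e l) = s * (w l * B l (e l)) := fun l => by
    have := congrFun h l
    simp only [Matrix.mulVec, dotProduct, Matrix.of_apply, mul_assoc, ← Finset.mul_sum,
      Pi.smul_apply, smul_eq_mul] at this
    rw [inv_mul_eq_iff_eq_mul₀ (he l).ne'] at this
    simp only [mul_comm (w _), this]
    ring
  have hpair : ∀ e' : {e : Fin m → Fin n // ∀ i, 0 < B i (e i)},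
      ∑ l, (∑ k, w k * A k (e'.1 l)) * v e' l =
        ρ e' * ∑ l, w l * B l (e'.1 l) * v e' l := fun e' => by
    simp only [Finset.sum_mul, Finset.mul_sum]
    rw [Finset.sum_comm]
    refine Finset.sum_congr rfl fun k _ => ?_
    have := congrArg (w k * ·) (hρ e' k)
    simp only [Finset.mul_sum] at this
    simp only [mul_assoc, this]
    ring
  have hpairpos : ∀ e' : {e : Fin m → Fin n // ∀ i, 0 < B i (e i)},
      0 < ∑ l, w l * B l (e'.1 l) * v e' l := fun e' =>
    Finset.sum_pos (fun l _ => mul_pos (mul_pos (hw l) (e'.2 l)) (hv e' l)) Finset.univ_nonempty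
  have hs : ρ ⟨e, he⟩ = s := by
    have h1 := hpair ⟨e, he⟩
    simp only [hleft, mul_assoc, ← Finset.mul_sum] at h1
    have h2 := hpairpos ⟨e, he⟩
    simp only [mul_assoc] at h2
    exact (mul_right_cancel₀ h2.ne' h1).symm
  have hopt : ∀ i j, 0 < B i j → s * (w i * B i j) ≤ ∑ k, w k * A k j := by
    intro i j hij
    by_contra! hlt
    have he' : ∀ k, 0 < B k (Function.update e i j k) := fun k => by
      by_cases hk : k = i
      · subst hk
        simpa using hij
      · simpa [hk] using he k
    set e' : {e : Fin m → Fin n // ∀ i, 0 < B i (e i)} := ⟨Function.update e i j, he'⟩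
    have h1 : ∑ l, (∑ k, w k * A k (e'.1 l)) * v e' l <
        ∑ l, s * (w l * B l (e'.1 l)) * v e' l := by
      refine Finset.sum_lt_sum (fun l _ => ?_) ⟨i, Finset.mem_univ i, ?_⟩
      · refine mul_le_mul_of_nonneg_right ?_ (hv e' l).le
        by_cases hl : l = i
        · subst hl
          simpa [e'] using hlt.le
        · simpa [e', hl] using (hleft l).le
      · refine mul_lt_mul_of_pos_right ?_ (hv e' i)
        simpa [e'] using hlt
    rw [hpair e'] at h1
    simp only [mul_assoc, ← Finset.mul_sum] at h1
    have h2 := hpairpos e'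
    simp only [mul_assoc] at h2
    exact absurd (hs ▸ hmin e') (not_le.2 (lt_of_mul_lt_mul_right h1 h2.le))
  refine ⟨e, s, v ⟨e, he⟩, he, ?_, hv _, hs ▸ hρ ⟨e, he⟩⟩
  have hcolumn : ∀ j, s * ∑ k, w k * B k j ≤ ∑ k, w k * A k j := fun j => by
    obtain ⟨i, hi, hiu⟩ := hcol j
    rw [Finset.sum_eq_single i (fun k _ hk => ?_) (by simp)]
    · exact hopt i j hi
    · rw [le_antisymm (not_lt.1 fun h => hk (hiu k h)) (hB k j), mul_zero]
  have hwB : 0 < w ⬝ᵥ (B *ᵥ x) := by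
    refine Finset.sum_pos (fun k _ => mul_pos (hw k) ?_) Finset.univ_nonempty
    exact Finset.sum_pos' (fun j _ => mul_nonneg (hB k j) (hx j).le)
      ⟨e k, Finset.mem_univ _, mul_pos (he k) (hx _)⟩
  refine le_of_mul_le_mul_right ?_ hwB
  calc s * (w ⬝ᵥ (B *ᵥ x)) = ∑ j, (s * ∑ k, w k * B k j) * x j := by
        rw [Matrix.dotProduct_mulVec, dotProduct, Finset.mul_sum]
        simp only [Matrix.vecMul, dotProduct, mul_assoc]
    _ ≤ ∑ j, (∑ k, w k * A k j) * x j :=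
        Finset.sum_le_sum fun j _ => mul_le_mul_of_nonneg_right (hcolumn j) (hx j).le
    _ = w ⬝ᵥ (A *ᵥ x) := by
        rw [Matrix.dotProduct_mulVec]
        rfl
    _ ≤ t * (w ⬝ᵥ (B *ᵥ x)) := by
        simp only [dotProduct, Finset.mul_sum]
        refine Finset.sum_le_sum fun k _ => ?_
        rw [mul_left_comm]
        exact mul_le_mul_of_nonneg_left (hxt k) (hw k).le

/-- A selection of columns meeting each row of `B` in a positive entry is injective, and the
selected submatrix of `B` is monomial. -/
lemma isMonomial_of_selection (hB : ∀ i j, 0 ≤ B i j) (hcol : ∀ j, ∃! i, 0 < B i j)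
    {e : Fin m → Fin n} (he : ∀ i, 0 < B i (e i)) :
    Function.Injective e ∧ IsMonomial (Matrix.of fun i k => B i (e k)) := by
  have huniq : ∀ i k, 0 < B i (e k) → i = k := fun i k h => (hcol (e k)).unique h (he k)
  exact ⟨fun k l hkl => huniq k l (hkl ▸ he k), fun i k => hB i (e k),
    fun i => ⟨i, he i, fun k hk => (huniq i k hk).symm⟩,
    fun k => ⟨k, he k, fun i hi => huniq i k hi⟩⟩

/-- Every Collatz–Wielandt bound of a WN-pair dominates, up to an arbitrarily small error, the
spectral radius of some monomial selection. -/
lemma exists_selection_specRad_le (hm : 0 < m) (hWN : WNpair A B) {x : Fin n → ℝ}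
    (hx : ∀ j, 0 < x j) {t : ℝ} (hxt : ∀ i, (A *ᵥ x) i ≤ t * (B *ᵥ x) i) {η : ℝ} (hη : 0 < η) :
    ∃ e : Fin m → Fin n, Function.Injective e ∧ IsMonomial (Matrix.of fun i k => B i (e k)) ∧
      specRad ((Matrix.of fun i k => B i (e k))⁻¹ * (Matrix.of fun i k => A i (e k))) ≤
        ENNReal.ofReal (t + η) := by
  obtain ⟨-, hA, hB, hrow, hcol⟩ := hWN
  have hBx : ∀ i, 0 < (B *ᵥ x) i := fun i => by
    obtain ⟨j, hj⟩ := hrow i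
    exact Finset.sum_pos' (fun j _ => mul_nonneg (hB i j) (hx j).le)
      ⟨j, Finset.mem_univ _, mul_pos hj (hx _)⟩
  obtain ⟨δ, hδ, -, hδη⟩ := exists_pos_mul_le (fun _ : Fin m => ∑ j, x j)
    (fun i => mul_pos hη (hBx i)) one_pos
  obtain ⟨e, r, v, he, hr, hv, h⟩ := exists_selection_of_pos
    (A := A + Matrix.of fun _ _ => δ) (t := t + η) hm
    (fun i j => add_pos_of_nonneg_of_pos (hA i j) hδ) hB hrow hcol hx fun i => by
      have h1 : ((Matrix.of fun (_ : Fin m) (_ : Fin n) => δ) *ᵥ x) i = δ * ∑ j, x j := by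
        simp [Matrix.mulVec, dotProduct, Finset.mul_sum]
      rw [Matrix.add_mulVec, Pi.add_apply, h1]
      linarith [hxt i, hδη i]
  obtain ⟨hinj, hM⟩ := isMonomial_of_selection hB hcol he
  refine ⟨e, hinj, hM, ?_⟩
  obtain ⟨D, hD0, hD⟩ := hM.exists_nonneg_left_inverse
  rw [Matrix.inv_eq_left_inv hD]
  have hC : ∀ i j, 0 ≤ (D * Matrix.of fun i k => A i (e k)) i j := fun i j => by
    rw [Matrix.mul_apply]
    exact Finset.sum_nonneg fun k _ => mul_nonneg (hD0 _ _) (hA _ _)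
  refine (specRad_le_ofReal hC hv fun i => ?_).trans (ENNReal.ofReal_le_ofReal hr)
  have hMv : r * v i = (D *ᵥ (r • (Matrix.of fun i k => B i (e k)) *ᵥ v)) i := by
    rw [Matrix.mulVec_smul, Matrix.mulVec_mulVec, hD, Matrix.one_mulVec]
    rfl
  rw [hMv, ← Matrix.mulVec_mulVec]
  refine dotProduct_le_dotProduct_of_nonneg_left (fun k => ?_) (hD0 i)
  have hBv : ((Matrix.of fun i k => B i (e k)) *ᵥ v) k = B k (e k) * v k := by
    simp only [Matrix.mulVec, dotProduct, Matrix.of_apply]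
    refine Finset.sum_eq_single k (fun l _ hl => ?_) (by simp)
    rw [le_antisymm (not_lt.1 fun h => hl ((hcol (e l)).unique (he l) h)) (hB _ _), zero_mul]
  rw [Pi.smul_apply, smul_eq_mul, hBv, ← h k]
  simp only [Matrix.mulVec, dotProduct, Matrix.of_apply, Matrix.add_apply]
  exact Finset.sum_le_sum fun l _ =>
    mul_le_mul_of_nonneg_right (le_add_of_nonneg_right hδ.le) (hv l).le

end Selection

/-- For a WN-pair, `ρ(A,B)` is the minimum over all monomial column selections `K` of
the spectral radius of `B[[m],K]⁻¹ A[[m],K]`, and each minimizing selection carries an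
optimal probability vector supported in `K` which is a GPF-eigenvector. -/
theorem stmt17 {m n : ℕ} (hm : 0 < m)
    (A B : Matrix (Fin m) (Fin n) ℝ)
    (hWN : WNpair A B) :
    cwRho A B = sInf {t : ℝ≥0∞ | ∃ e : Fin m → Fin n, Function.Injective e ∧
        IsMonomial (Matrix.of fun i k => B i (e k)) ∧
        t = specRad ((Matrix.of fun i k => B i (e k))⁻¹ *
          (Matrix.of fun i k => A i (e k)))} ∧
    ∀ e : Fin m → Fin n, Function.Injective e →
      IsMonomial (Matrix.of fun i k => B i (e k)) →
      specRad ((Matrix.of fun i k => B i (e k))⁻¹ *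
          (Matrix.of fun i k => A i (e k))) = cwRho A B →
      ∃ y : Fin n → ℝ, OptimalVec A B y ∧ (∑ j, y j) = 1 ∧
        (∀ j, 0 < y j → ∃ k, e k = j) ∧
        A.mulVec y = (cwRho A B).toReal • B.mulVec y := by
  have hle : ∀ e : Fin m → Fin n, Function.Injective e →
      IsMonomial (Matrix.of fun i k => B i (e k)) →
      cwRho A B ≤ specRad ((Matrix.of fun i k => B i (e k))⁻¹ *
          (Matrix.of fun i k => A i (e k))) := by
    intro e he hM
    obtain ⟨r, y, rk, yk, -, hrho, -, -, -, -, -, hyk, hcw, -, hlimr⟩ :=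
      exists_generalized_eigenvector hm hWN.2.1 hWN.2.2.1 he hM
    rw [hrho]
    exact ge_of_tendsto' (ENNReal.tendsto_ofReal hlimr) fun k =>
      (cwRho_le_cwR (hyk k)).trans (hcw k)
  refine ⟨le_antisymm (le_sInf ?_) (le_sInf ?_), fun e he hM heq => ?_⟩
  · rintro _ ⟨e, he, hM, rfl⟩
    exact hle e he hM
  · rintro _ ⟨x, hx, rfl⟩
    refine le_sInf ?_
    rintro _ ⟨s, hs, rfl, hxs⟩
    have hlim : Tendsto (fun η : ℝ => ENNReal.ofReal (s + η)) (𝓝[>] 0)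
        (𝓝 (ENNReal.ofReal s)) := by
      refine ENNReal.tendsto_ofReal (tendsto_nhdsWithin_of_tendsto_nhds ?_)
      simpa using (continuous_const_add s).tendsto (0 : ℝ)
    refine ge_of_tendsto hlim (eventually_mem_nhdsWithin.mono fun η hη => ?_)
    obtain ⟨e, he, hM, hspec⟩ := exists_selection_specRad_le hm hWN hx hxs hη
    exact sInf_le_of_le ⟨e, he, hM, rfl⟩ hspec
  · obtain ⟨r, y, rk, yk, hr, hrho, hy0, hy1, hsupp, hAy, ⟨i, hi⟩, hyk, hcw, hlimy, hlimr⟩ :=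
      exists_generalized_eigenvector hm hWN.2.1 hWN.2.2.1 he hM
    rw [hrho] at heq
    refine ⟨y, ⟨hy0, ?_, (cwR_eq_ofReal hr hAy hi).trans heq, yk, hyk, hlimy, ?_⟩, hy1, hsupp, ?_⟩
    · rintro rfl
      simp at hy1
    · exact tendsto_of_tendsto_of_tendsto_of_le_of_le tendsto_const_nhds
        (heq ▸ ENNReal.tendsto_ofReal hlimr) (fun k => cwRho_le_cwR (hyk k)) hcw
    · rw [← heq, ENNReal.toReal_ofReal hr, hAy]
end
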